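/- arXiv:cs/0607034 — 7 statements merged into one kernel-verified Lean document; each statement's English description precedes it below -/
import Mathlib

section
/- The constant exp( − Σ_{m=1}^{∞} m!/(m^{m+2} log 2) ) lies strictly between 0.18820 and 0.18821 (its value is 0.188209…). In particular the series Σ_{m≥1} m!/(m^{m+2} log 2) converges. -/
/-- The general term `n! / n ^ (n + 2)` with `n = m + 1`. -/
noncomputable def factorialRatio (m : ℕ) : ℝ :=
  (Nat.factorial (m + 1) : ℝ) / (m + 1 : ℝ) ^ (m + 3)

lemma factorialRatio_nonneg (m : ℕ) : 0 ≤ factorialRatio m := by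
  unfold factorialRatio; positivity

lemma factorialRatio_succ_le (m : ℕ) : factorialRatio (m + 1) ≤ factorialRatio m * (1 / 2) := by
  have hB := one_add_mul_le_pow (a := 1 / (m + 1 : ℝ))
    (le_trans (by norm_num) (by positivity : (0 : ℝ) ≤ 1 / (m + 1 : ℝ))) (m + 3)
  have h2 : (2 : ℝ) ≤ (1 + 1 / (m + 1 : ℝ)) ^ (m + 3) := by
    refine le_trans ?_ hB
    have : ((m + 3 : ℕ) : ℝ) * (1 / (m + 1 : ℝ)) = 1 + 2 / (m + 1 : ℝ) := by
      push_cast; field_simp; ring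
    have h0 : (0 : ℝ) ≤ 2 / (m + 1 : ℝ) := by positivity
    rw [this]; linarith
  have h3 : (m + 2 : ℝ) ^ (m + 3) = (m + 1 : ℝ) ^ (m + 3) * (1 + 1 / (m + 1 : ℝ)) ^ (m + 3) := by
    rw [← mul_pow]; congr 1; field_simp; ring
  have h4 : 2 * (m + 1 : ℝ) ^ (m + 3) ≤ (m + 2 : ℝ) ^ (m + 3) := by
    rw [h3, mul_comm]; gcongr
  have h5 : factorialRatio (m + 1) = (Nat.factorial (m + 1) : ℝ) / (m + 2 : ℝ) ^ (m + 3) := by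
    unfold factorialRatio
    rw [Nat.factorial_succ (m + 1), show m + 1 + 3 = (m + 3) + 1 by ring, pow_succ]
    push_cast
    rw [show (m + 1 + 1 : ℝ) = m + 2 by ring]
    field_simp
  rw [h5, factorialRatio, div_mul_div_comm, mul_one, mul_comm _ (2 : ℝ)]
  gcongr

lemma factorialRatio_add_le (N m : ℕ) :
    factorialRatio (m + N) ≤ factorialRatio N * (1 / 2) ^ m := by
  induction m with
  | zero => simp
  | succ k ih =>
    rw [show k + 1 + N = (k + N) + 1 by ring, pow_succ, ← mul_assoc]
    exact (factorialRatio_succ_le _).trans (by gcongr)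

lemma summable_factorialRatio : Summable factorialRatio :=
  Summable.of_nonneg_of_le factorialRatio_nonneg (fun m => factorialRatio_add_le 0 m)
    (summable_geometric_two.mul_left _)

lemma tsum_factorialRatio_le (N : ℕ) :
    ∑' m, factorialRatio m ≤ ∑ m ∈ Finset.range N, factorialRatio m + 2 * factorialRatio N := by
  rw [← summable_factorialRatio.sum_add_tsum_nat_add N]
  gcongr
  calc ∑' m, factorialRatio (m + N) ≤ ∑' m, factorialRatio N * (1 / 2) ^ m :=
        ((summable_nat_add_iff N).2 summable_factorialRatio).tsum_le_tsum
          (factorialRatio_add_le N) (summable_geometric_two.mul_left _)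
    _ = 2 * factorialRatio N := by rw [tsum_mul_left, tsum_geometric_two, mul_comm]

lemma lt_tsum_factorialRatio : 1.157694 < ∑' m, factorialRatio m := by
  refine lt_of_lt_of_le ?_ (summable_factorialRatio.sum_le_tsum (Finset.range 11)
    fun m _ => factorialRatio_nonneg m)
  norm_num [Finset.sum_range_succ, factorialRatio, Nat.factorial]

lemma tsum_factorialRatio_lt : ∑' m, factorialRatio m < 1.157697 := by
  refine (tsum_factorialRatio_le 11).trans_lt ?_
  norm_num [Finset.sum_range_succ, factorialRatio, Nat.factorial]

lemma exp_lt_inv : Real.exp 1.67021 < 0.18820⁻¹ := by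
  have h := Real.exp_bound' (x := 1.67021 / 2) (by norm_num) (by norm_num) (n := 10) (by norm_num)
  rw [show (1.67021 : ℝ) = 1.67021 / 2 + 1.67021 / 2 by norm_num, Real.exp_add, ← sq]
  refine (pow_le_pow_left₀ (Real.exp_pos _).le h 2).trans_lt ?_
  norm_num [Finset.sum_range_succ, Nat.factorial]

lemma inv_lt_exp : 0.18821⁻¹ < Real.exp 1.670199 := by
  refine lt_of_lt_of_le ?_ (Real.sum_le_exp_of_nonneg (by norm_num) 14)
  norm_num [Finset.sum_range_succ, Nat.factorial]

/-- The series `∑_{m≥1} m!/(m^{m+2} log 2)` converges and the constant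
`exp (-∑_{m≥1} m!/(m^{m+2} log 2)) = 0.188209…` lies strictly between
`0.18820` and `0.18821`. (The index `m ≥ 1` is represented by `m + 1`, `m : ℕ`.) -/
theorem stmt_11 :
    Summable (fun m : ℕ =>
      (Nat.factorial (m + 1) : ℝ) / ((m + 1 : ℝ) ^ (m + 3) * Real.log 2)) ∧
    0.18820 < Real.exp (-∑' m : ℕ,
      (Nat.factorial (m + 1) : ℝ) / ((m + 1 : ℝ) ^ (m + 3) * Real.log 2)) ∧
    Real.exp (-∑' m : ℕ,
      (Nat.factorial (m + 1) : ℝ) / ((m + 1 : ℝ) ^ (m + 3) * Real.log 2)) < 0.18821 := by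
  have hf : (fun m : ℕ =>
      (Nat.factorial (m + 1) : ℝ) / ((m + 1 : ℝ) ^ (m + 3) * Real.log 2)) =
      fun m => factorialRatio m / Real.log 2 := by
    funext m
    rw [factorialRatio, div_div]
  have hlog : 0 < Real.log 2 := Real.log_pos one_lt_two
  have hgt := Real.log_two_gt_d9
  have hlt := Real.log_two_lt_d9
  have hlower := lt_tsum_factorialRatio
  have hupper := tsum_factorialRatio_lt
  rw [hf, tsum_div_const, Real.exp_neg]
  refine ⟨summable_factorialRatio.div_const _, ?_, ?_⟩
  · rw [lt_inv_comm₀ (by norm_num) (Real.exp_pos _)]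
    refine lt_of_le_of_lt (Real.exp_le_exp.2 ?_) exp_lt_inv
    rw [div_le_iff₀ hlog]
    linarith
  · rw [inv_lt_comm₀ (Real.exp_pos _) (by norm_num)]
    refine inv_lt_exp.trans_le (Real.exp_le_exp.2 ?_)
    rw [le_div_iff₀ hlog]
    linarith
end

section
/- The constant exp( − Σ_{m=1}^{∞} m!/(2^m m^{m+2} log 2) ) lies strictly between 0.462 and 0.463. In particular the series Σ_{m≥1} m!/(2^m m^{m+2} log 2) converges. -/
/-- The `m`-th term of `∑ (m+1)! / (2^(m+1) (m+1)^(m+3))`. -/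
noncomputable def factorialTerm (m : ℕ) : ℝ :=
  (Nat.factorial (m + 1) : ℝ) / (2 ^ (m + 1) * (m + 1 : ℝ) ^ (m + 3))

lemma factorialTerm_nonneg (m : ℕ) : 0 ≤ factorialTerm m := by
  unfold factorialTerm
  positivity

lemma factorialTerm_succ_le (m : ℕ) : factorialTerm (m + 1) ≤ factorialTerm m * (1 / 2) := by
  have h : factorialTerm (m + 1) =
      (Nat.factorial (m + 1) : ℝ) / (2 ^ (m + 2) * (m + 2 : ℝ) ^ (m + 3)) := by
    unfold factorialTerm
    rw [Nat.factorial_succ (m + 1)]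
    push_cast
    have h2 : (m : ℝ) + 1 + 1 = m + 2 := by ring
    rw [h2]
    field_simp
    ring
  have h' : factorialTerm m * (1 / 2) =
      (Nat.factorial (m + 1) : ℝ) / (2 ^ (m + 2) * (m + 1 : ℝ) ^ (m + 3)) := by
    unfold factorialTerm
    field_simp
    ring
  rw [h, h']
  gcongr
  norm_num

lemma factorialTerm_add_le (k m : ℕ) :
    factorialTerm (m + k) ≤ factorialTerm k * (1 / 2) ^ m := by
  induction m with
  | zero => simp
  | succ m ih =>
    rw [Nat.add_right_comm, pow_succ, ← mul_assoc]
    exact (factorialTerm_succ_le _).trans (by gcongr)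

lemma summable_factorialTerm : Summable factorialTerm :=
  Summable.of_nonneg_of_le factorialTerm_nonneg (factorialTerm_add_le 0)
    (summable_geometric_two.mul_left _)

lemma tsum_factorialTerm_le (k : ℕ) :
    ∑' m, factorialTerm m ≤ ∑ m ∈ Finset.range k, factorialTerm m + factorialTerm k * 2 := by
  rw [← summable_factorialTerm.sum_add_tsum_nat_add k, ← tsum_geometric_two, ← tsum_mul_left]
  gcongr with m
  · exact (summable_nat_add_iff k).2 summable_factorialTerm
  · exact summable_geometric_two.mul_left _
  · exact factorialTerm_add_le k m

lemma tsum_factorialTerm_lt : ∑' m, factorialTerm m < 0.5348 := by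
  refine (tsum_factorialTerm_le 4).trans_lt ?_
  norm_num [Finset.sum_range_succ, factorialTerm, Nat.factorial]

lemma lt_tsum_factorialTerm : 0.5343 < ∑' m, factorialTerm m := by
  refine lt_of_lt_of_le ?_
    (summable_factorialTerm.sum_le_tsum (Finset.range 3) fun m _ => factorialTerm_nonneg m)
  norm_num [Finset.sum_range_succ, factorialTerm, Nat.factorial]

lemma lt_exp_neg_of_le {x : ℝ} (hx : x ≤ 0.7716) : 0.462 < Real.exp (-x) := by
  have h : Real.exp 0.7716 < 0.462⁻¹ := by
    refine (Real.exp_bound' (by norm_num) (by norm_num) (n := 9) (by norm_num)).trans_lt ?_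
    norm_num [Finset.sum_range_succ, Nat.factorial]
  rw [Real.exp_neg]
  exact (lt_inv_comm₀ (Real.exp_pos _) (by norm_num)).1
    ((Real.exp_le_exp.2 hx).trans_lt h)

lemma exp_neg_lt_of_le {x : ℝ} (hx : 0.7708 ≤ x) : Real.exp (-x) < 0.463 := by
  have h : 0.463⁻¹ < Real.exp 0.7708 := by
    refine lt_of_lt_of_le ?_ (Real.sum_le_exp_of_nonneg (by norm_num) 9)
    norm_num [Finset.sum_range_succ, Nat.factorial]
  rw [Real.exp_neg]
  exact (inv_lt_comm₀ (by norm_num) (Real.exp_pos _)).1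
    (h.trans_le (Real.exp_le_exp.2 hx))

/-- The series `∑_{m≥1} m!/(2^m m^{m+2} log 2)` converges and the constant
`exp (-∑_{m≥1} m!/(2^m m^{m+2} log 2)) = 0.462…` lies strictly between
`0.462` and `0.463`. (The index `m ≥ 1` is represented by `m + 1`, `m : ℕ`.) -/
theorem stmt_12 :
    Summable (fun m : ℕ =>
      (Nat.factorial (m + 1) : ℝ) / (2 ^ (m + 1) * (m + 1 : ℝ) ^ (m + 3) * Real.log 2)) ∧
    0.462 < Real.exp (-∑' m : ℕ,
      (Nat.factorial (m + 1) : ℝ) / (2 ^ (m + 1) * (m + 1 : ℝ) ^ (m + 3) * Real.log 2)) ∧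
    Real.exp (-∑' m : ℕ,
      (Nat.factorial (m + 1) : ℝ) / (2 ^ (m + 1) * (m + 1 : ℝ) ^ (m + 3) * Real.log 2))
      < 0.463 := by
  have hlog : (fun m : ℕ =>
      (Nat.factorial (m + 1) : ℝ) / (2 ^ (m + 1) * (m + 1 : ℝ) ^ (m + 3) * Real.log 2)) =
      fun m => factorialTerm m / Real.log 2 := by
    funext m
    rw [factorialTerm, div_div]
  have hpos : 0 < Real.log 2 := Real.log_pos one_lt_two
  rw [hlog, tsum_div_const]
  refine ⟨summable_factorialTerm.div_const _, lt_exp_neg_of_le ?_, exp_neg_lt_of_le ?_⟩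
  · rw [div_le_iff₀ hpos]
    linarith [tsum_factorialTerm_lt, Real.log_two_gt_d9]
  · rw [le_div_iff₀ hpos]
    linarith [lt_tsum_factorialTerm, Real.log_two_lt_d9]
end

section
/- The series Σ_{m=1}^{∞} m!/(2^m m^{m+1} log 2) converges and its sum lies strictly between 0.827 and 0.828 (its value is 0.8274…). -/
/-- The `m`-th term, up to the factor `1 / log 2`. -/
noncomputable def seriesTerm (m : ℕ) : ℝ :=
  (Nat.factorial (m + 1) : ℝ) / (2 ^ (m + 1) * (m + 1 : ℝ) ^ (m + 2))

lemma seriesTerm_pos (m : ℕ) : 0 < seriesTerm m := by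
  unfold seriesTerm
  positivity

lemma seriesTerm_succ_le (m : ℕ) : seriesTerm (m + 1) ≤ seriesTerm m * (1 / 2) := by
  have hpow : (m + 1 : ℝ) ^ (m + 2) ≤ (m + 2 : ℝ) ^ (m + 2) := by
    gcongr
    norm_num
  have heq : seriesTerm (m + 1) =
      (Nat.factorial (m + 1) : ℝ) / (2 ^ (m + 1) * (m + 2 : ℝ) ^ (m + 2)) * (1 / 2) := by
    unfold seriesTerm
    rw [Nat.factorial_succ (m + 1)]
    push_cast
    rw [show (m + 1 + 1 : ℝ) = m + 2 by ring]
    field_simp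
    ring
  rw [heq]
  unfold seriesTerm
  gcongr

lemma seriesTerm_add_le (k m : ℕ) : seriesTerm (m + k) ≤ seriesTerm k * (1 / 2) ^ m := by
  induction m with
  | zero => simp
  | succ m ih =>
    rw [Nat.add_right_comm, pow_succ, ← mul_assoc]
    exact (seriesTerm_succ_le _).trans (by gcongr)

lemma summable_seriesTerm : Summable seriesTerm :=
  Summable.of_nonneg_of_le (fun m => (seriesTerm_pos m).le) (seriesTerm_add_le 0)
    (summable_geometric_two.mul_left _)

lemma sum_range_le_tsum_seriesTerm (k : ℕ) :
    ∑ m ∈ Finset.range k, seriesTerm m ≤ ∑' m, seriesTerm m :=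
  summable_seriesTerm.sum_le_tsum _ fun m _ => (seriesTerm_pos m).le

lemma tsum_seriesTerm_le (k : ℕ) :
    ∑' m, seriesTerm m ≤ ∑ m ∈ Finset.range k, seriesTerm m + seriesTerm k * 2 := by
  rw [← summable_seriesTerm.sum_add_tsum_nat_add k, ← tsum_geometric_two, ← tsum_mul_left]
  gcongr
  · exact (summable_nat_add_iff k).2 summable_seriesTerm
  · exact summable_geometric_two.mul_left _
  · exact seriesTerm_add_le k _

/-- The series `∑_{m≥1} m!/(2^m m^{m+1} log 2)` converges and its sum `0.8274…`
lies strictly between `0.827` and `0.828`.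
(The index `m ≥ 1` is represented by `m + 1`, `m : ℕ`.) -/
theorem stmt_13 :
    Summable (fun m : ℕ =>
      (Nat.factorial (m + 1) : ℝ) / (2 ^ (m + 1) * (m + 1 : ℝ) ^ (m + 2) * Real.log 2)) ∧
    0.827 < (∑' m : ℕ,
      (Nat.factorial (m + 1) : ℝ) / (2 ^ (m + 1) * (m + 1 : ℝ) ^ (m + 2) * Real.log 2)) ∧
    (∑' m : ℕ,
      (Nat.factorial (m + 1) : ℝ) / (2 ^ (m + 1) * (m + 1 : ℝ) ^ (m + 2) * Real.log 2))
      < 0.828 := by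
  have hlog : 0 < Real.log 2 := Real.log_pos one_lt_two
  have hterm : (fun m : ℕ =>
      (Nat.factorial (m + 1) : ℝ) / (2 ^ (m + 1) * (m + 1 : ℝ) ^ (m + 2) * Real.log 2)) =
      fun m => seriesTerm m / Real.log 2 := by
    funext m
    rw [seriesTerm, div_div]
  have hlower := sum_range_le_tsum_seriesTerm 5
  have hupper := tsum_seriesTerm_le 5
  have hsum : ∑ m ∈ Finset.range 5, seriesTerm m = 99094597 / 172800000 := by
    norm_num [Finset.sum_range_succ, seriesTerm, Nat.factorial]
  have hnext : seriesTerm 5 < 1 / 10000 := by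
    norm_num [seriesTerm, Nat.factorial]
  rw [hterm, tsum_div_const, lt_div_iff₀ hlog, div_lt_iff₀ hlog]
  refine ⟨summable_seriesTerm.div_const _, ?_, ?_⟩
  · linarith [Real.log_two_lt_d9]
  · linarith [Real.log_two_gt_d9]
end

section
/- Let q ∈ (0,1) and α > 1 satisfy α(1−q) < 1, and set c_q(α) = q α³ / ((α−1)(1 − α(1−q))). For n ≥ 2 set j*(n) = ⌈log_α(log₂ n)⌉. Then the double series Σ_{k=1}^{∞} Σ_{j=1}^{j*(n)+k} (1 + α^j) q (1−q)^{k−1} converges for each n, and there exists a constant C such that for all n ≥ 3, Σ_{k=1}^{∞} Σ_{j=1}^{j*(n)+k} (1 + α^j) q (1−q)^{k−1} ≤ c_q(α) log₂ n + C log(log n). -/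
open Finset

lemma sum_Icc_one_add_pow {α : ℝ} (hα : α ≠ 1) (N : ℕ) :
    ∑ j ∈ Finset.Icc 1 N, (1 + α ^ j) = N + (α ^ (N + 1) - α) / (α - 1) := by
  have h : α - 1 ≠ 0 := sub_ne_zero.2 hα
  induction N with
  | zero => simp
  | succ N ih =>
    rw [Finset.sum_Icc_succ_top (by omega), ih]
    push_cast
    field_simp
    ring

/-- Closed form of the double series with the inner sum running up to `m + (k + 1)`. -/
lemma hasSum_sum_Icc_geometric {q α : ℝ} (hq0 : 0 < q) (hq1 : q < 1) (hα : 1 < α)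
    (hαq : α * (1 - q) < 1) (m : ℕ) :
    HasSum (fun k : ℕ => ∑ j ∈ Finset.Icc 1 (m + (k + 1)), (1 + α ^ j) * q * (1 - q) ^ k)
      (m + 1 / q + q * α ^ (m + 2) / ((α - 1) * (1 - α * (1 - q))) - α / (α - 1)) := by
  have hα1 : α - 1 ≠ 0 := by linarith
  have hd : 1 - α * (1 - q) ≠ 0 := by linarith
  have hr0 : 0 ≤ 1 - q := by linarith
  have h1 : HasSum (fun k : ℕ => (1 - q) ^ k) (1 - (1 - q))⁻¹ :=
    hasSum_geometric_of_lt_one hr0 (by linarith)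
  have h2 : HasSum (fun k : ℕ => (α * (1 - q)) ^ k) (1 - α * (1 - q))⁻¹ :=
    hasSum_geometric_of_lt_one (by positivity) hαq
  have h3 : HasSum (fun k : ℕ => (k : ℝ) * (1 - q) ^ k) ((1 - q) / (1 - (1 - q)) ^ 2) :=
    hasSum_coe_mul_geometric_of_norm_lt_one
      (by rw [Real.norm_of_nonneg hr0]; linarith)
  have h := ((h1.mul_left ((m + 1 - α / (α - 1)) * q)).add (h3.mul_left q)).add
    (h2.mul_left (q * α ^ (m + 2) / (α - 1)))
  have hval : m + 1 / q + q * α ^ (m + 2) / ((α - 1) * (1 - α * (1 - q))) - α / (α - 1)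
      = (m + 1 - α / (α - 1)) * q * (1 - (1 - q))⁻¹ + q * ((1 - q) / (1 - (1 - q)) ^ 2)
        + q * α ^ (m + 2) / (α - 1) * (1 - α * (1 - q))⁻¹ := by
    rw [sub_sub_cancel]
    field_simp
    ring
  rw [hval]
  refine h.congr_fun fun k => ?_
  rw [← Finset.sum_mul, ← Finset.sum_mul, sum_Icc_one_add_pow hα.ne']
  push_cast
  rw [mul_pow]
  field_simp
  ring

lemma pow_ceil_logb_le {α x : ℝ} (hα : 1 < α) (hx : 1 ≤ x) :
    α ^ ⌈Real.logb α x⌉₊ ≤ α * x := by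
  have hα0 : 0 < α := by linarith
  have hx0 : 0 < x := by linarith
  have hm := (Nat.ceil_lt_add_one (Real.logb_nonneg hα hx)).le
  calc α ^ ⌈Real.logb α x⌉₊ = α ^ ((⌈Real.logb α x⌉₊ : ℕ) : ℝ) := (Real.rpow_natCast _ _).symm
    _ ≤ α ^ (Real.logb α x + 1) := Real.rpow_le_rpow_of_exponent_le hα.le hm
    _ = α * x := by
      rw [Real.rpow_add hα0, Real.rpow_logb hα0 hα.ne' hx0, Real.rpow_one, mul_comm]

lemma one_lt_log_three : 1 < Real.log 3 := by
  rw [Real.lt_log_iff_exp_lt (by norm_num)]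
  linarith [Real.exp_one_lt_d9]

/-- For `q ∈ (0,1)` and `α > 1` with `α (1-q) < 1`, setting
`c_q(α) = q α³ / ((α-1)(1 - α(1-q)))` and `j*(n) = ⌈log_α (log₂ n)⌉`, the double
series `∑_{k=1}^∞ ∑_{j=1}^{j*(n)+k} (1 + α^j) q (1-q)^{k-1}` converges for each `n`,
and there is a constant `C` such that for all `n ≥ 3` it is at most
`c_q(α) log₂ n + C log (log n)`. (The index `k ≥ 1` is represented by `k + 1`, `k : ℕ`.) -/
theorem stmt_14 (q α : ℝ) (hq0 : 0 < q) (hq1 : q < 1) (hα : 1 < α)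
    (hαq : α * (1 - q) < 1)
    (c : ℝ) (hc : c = q * α ^ 3 / ((α - 1) * (1 - α * (1 - q))))
    (jstar : ℕ → ℕ) (hjstar : ∀ n : ℕ, jstar n = ⌈Real.logb α (Real.logb 2 n)⌉₊) :
    (∀ n : ℕ, Summable (fun k : ℕ =>
      ∑ j ∈ Finset.Icc 1 (jstar n + (k + 1)), (1 + α ^ j) * q * (1 - q) ^ k)) ∧
    ∃ C : ℝ, ∀ n : ℕ, 3 ≤ n →
      (∑' k : ℕ, ∑ j ∈ Finset.Icc 1 (jstar n + (k + 1)), (1 + α ^ j) * q * (1 - q) ^ k)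
        ≤ c * Real.logb 2 n + C * Real.log (Real.log n) := by
  refine ⟨fun n => (hasSum_sum_Icc_geometric hq0 hq1 hα hαq (jstar n)).summable, ?_⟩
  set δ := Real.log (Real.log 3)
  have hδ0 : 0 < δ := Real.log_pos one_lt_log_three
  set D := |1 + 1 / q - Real.log (Real.log 2) / Real.log α|
  refine ⟨1 / Real.log α + D / δ, fun n hn => ?_⟩
  rw [(hasSum_sum_Icc_geometric hq0 hq1 hα hαq (jstar n)).tsum_eq, hjstar]
  have hn3 : (3 : ℝ) ≤ n := by exact_mod_cast hn
  have hlog3 : Real.log 3 ≤ Real.log n := Real.log_le_log (by norm_num) hn3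
  have hlogn : 1 < Real.log n := one_lt_log_three.trans_le hlog3
  have hlog2 : 0 < Real.log 2 := Real.log_pos (by norm_num)
  have hL : 1 ≤ Real.logb 2 n := by
    rw [Real.le_logb_iff_rpow_le (by norm_num) (by linarith)]
    norm_num
    linarith
  have hpow := pow_ceil_logb_le hα hL
  have hm := (Nat.ceil_lt_add_one (Real.logb_nonneg hα hL)).le
  have hlogb : Real.logb α (Real.logb 2 n)
      = Real.log (Real.log n) / Real.log α - Real.log (Real.log 2) / Real.log α := by
    rw [Real.logb, Real.logb, Real.log_div (by linarith) hlog2.ne', sub_div]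
  have hδn : δ ≤ Real.log (Real.log n) :=
    Real.log_le_log (by linarith [one_lt_log_three]) hlog3
  have hDn : D ≤ D / δ * Real.log (Real.log n) := by
    calc D = D / δ * δ := by field_simp
      _ ≤ _ := by gcongr
  have hmain : q * α ^ (⌈Real.logb α (Real.logb 2 n)⌉₊ + 2) / ((α - 1) * (1 - α * (1 - q)))
      ≤ c * Real.logb 2 n := by
    have hα1 : 0 < α - 1 := by linarith
    have hd : 0 < 1 - α * (1 - q) := by linarith
    rw [hc, div_mul_eq_mul_div, pow_add]
    gcongr ?_ / _
    calc q * (α ^ ⌈Real.logb α (Real.logb 2 n)⌉₊ * α ^ 2)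
        ≤ q * (α * Real.logb 2 n * α ^ 2) := by gcongr
      _ = _ := by ring
  have hpos : 0 < α / (α - 1) := div_pos (by linarith) (by linarith)
  have hDle := le_abs_self (1 + 1 / q - Real.log (Real.log 2) / Real.log α)
  have : (1 / Real.log α + D / δ) * Real.log (Real.log n)
      = Real.log (Real.log n) / Real.log α + D / δ * Real.log (Real.log n) := by ring
  linarith
end

section
/- There exists a constant C > 0 such that for every integer n ≥ 2 and every integer r ≥ 1, Σ_{k=1}^{r} ( n(n−1)/2 ) / 4^k · (1 − 1/2^k)^{n−2} ≤ C. -/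
open Finset

/-- A cubic times a decaying exponential is bounded on the nonnegative half-line. -/
lemma two_add_pow_three_mul_exp_neg_le (t : ℝ) (ht : 0 ≤ t) :
    (2 + t) ^ 3 * Real.exp (-t) ≤ 6 * Real.exp 2 := by
  have h := Real.pow_div_factorial_le_exp (2 + t) (by linarith) 3
  have h6 : ((Nat.factorial 3 : ℕ) : ℝ) = 6 := by norm_num [Nat.factorial]
  rw [h6, div_le_iff₀ (by norm_num)] at h
  calc (2 + t) ^ 3 * Real.exp (-t) ≤ Real.exp (2 + t) * 6 * Real.exp (-t) := by gcongr
    _ = 6 * Real.exp 2 := by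
      rw [mul_right_comm, ← Real.exp_add, add_neg_cancel_right, mul_comm]

/-- The witness probability at wake-up probability `x` is bounded by an increment of
`s ↦ 1 / (1 + s)` between `n * x` and `n * x / 2`. -/
lemma choose_two_mul_sq_mul_one_sub_pow_le (n : ℕ) (hn : 2 ≤ n) (x : ℝ) (hx : 0 < x)
    (hx' : x ≤ 1 / 2) :
    (n : ℝ) * (n - 1) / 2 * x ^ 2 * (1 - x) ^ (n - 2) ≤
      6 * Real.exp 3 * (1 / (1 + n * x / 2) - 1 / (1 + n * x)) := by
  have hn' : (2 : ℝ) ≤ n := by exact_mod_cast hn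
  set t : ℝ := n * x with htdef
  have ht : 0 < t := by positivity
  have hpow : (1 - x) ^ (n - 2) ≤ Real.exp 1 * Real.exp (-t) := by
    calc (1 - x) ^ (n - 2) ≤ Real.exp (-x) ^ (n - 2) :=
          pow_le_pow_left₀ (by linarith) (Real.one_sub_le_exp_neg x) _
      _ = Real.exp (2 * x - t) := by
          rw [← Real.exp_nat_mul, Nat.cast_sub hn, htdef]
          congr 1
          push_cast
          ring
      _ ≤ Real.exp (1 + -t) := Real.exp_le_exp.mpr (by linarith)
      _ = _ := Real.exp_add _ _
  have hcoef : (n : ℝ) * (n - 1) / 2 * x ^ 2 ≤ t ^ 2 := by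
    rw [htdef, mul_pow]
    gcongr
    nlinarith
  have hdiff : 1 / (1 + t / 2) - 1 / (1 + t) = t / ((1 + t) * (2 + t)) := by
    field_simp
    ring
  rw [hdiff, mul_div_assoc', le_div_iff₀ (by positivity)]
  calc (n : ℝ) * (n - 1) / 2 * x ^ 2 * (1 - x) ^ (n - 2) * ((1 + t) * (2 + t))
      ≤ t ^ 2 * (Real.exp 1 * Real.exp (-t)) * ((1 + t) * (2 + t)) := by
        have h0 : 0 ≤ (1 - x) ^ (n - 2) := pow_nonneg (by linarith) _
        gcongr
    _ = Real.exp 1 * t * (t * (1 + t) * (2 + t) * Real.exp (-t)) := by ring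
    _ ≤ Real.exp 1 * t * ((2 + t) ^ 3 * Real.exp (-t)) := by
        gcongr
        nlinarith [mul_pos ht ht]
    _ ≤ Real.exp 1 * t * (6 * Real.exp 2) := by
        exact mul_le_mul_of_nonneg_left (two_add_pow_three_mul_exp_neg_le t ht.le)
          (by positivity)
    _ = 6 * Real.exp 3 * t := by
        rw [show (3 : ℝ) = 1 + 2 by norm_num, Real.exp_add]
        ring

/-- There is a constant `C > 0` such that for every `n ≥ 2` and every `r ≥ 1`,
`∑_{k=1}^r (n(n-1)/2)/4^k · (1 - 1/2^k)^{n-2} ≤ C`: the expected number of witnesses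
created per round of Algorithm 2 is `O(1)`, uniformly in `n` and `r`. -/
theorem stmt_15 :
    ∃ C : ℝ, 0 < C ∧ ∀ n : ℕ, 2 ≤ n → ∀ r : ℕ, 1 ≤ r →
      ∑ k ∈ Finset.Icc 1 r,
        ((n : ℝ) * (n - 1) / 2) / 4 ^ k * (1 - 1 / 2 ^ k) ^ (n - 2) ≤ C := by
  refine ⟨6 * Real.exp 3, by positivity, fun n hn r hr => ?_⟩
  clear hr
  have key : ∑ k ∈ Finset.Icc 1 r,
      ((n : ℝ) * (n - 1) / 2) / 4 ^ k * (1 - 1 / 2 ^ k) ^ (n - 2) ≤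
        6 * Real.exp 3 * (1 / (1 + n * (1 / 2 ^ (r + 1)))) := by
    induction r with
    | zero =>
      rw [Finset.Icc_eq_empty_of_lt zero_lt_one, Finset.sum_empty]
      positivity
    | succ r ih =>
      rw [Finset.sum_Icc_succ_top (by omega)]
      have hx : (1 : ℝ) / 2 ^ (r + 1) ≤ 1 / 2 := by
        rw [pow_succ]
        gcongr
        nlinarith [one_le_pow₀ (n := r) (one_le_two : (1 : ℝ) ≤ 2)]
      have h := choose_two_mul_sq_mul_one_sub_pow_le n hn (1 / 2 ^ (r + 1)) (by positivity) hx
      have h4 : (n : ℝ) * (n - 1) / 2 * (1 / 2 ^ (r + 1)) ^ 2 =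
          (n : ℝ) * (n - 1) / 2 / 4 ^ (r + 1) := by
        rw [div_pow, one_pow, ← pow_mul, mul_comm (r + 1) 2, pow_mul, mul_one_div]
        norm_num
      have h2 : (n : ℝ) * (1 / 2 ^ (r + 1)) / 2 = n * (1 / 2 ^ (r + 1 + 1)) := by
        rw [pow_succ _ (r + 1)]
        field_simp
      rw [h4, h2] at h
      linarith
  refine key.trans (mul_le_of_le_one_right (by positivity) ?_)
  rw [div_le_one (by positivity)]
  exact le_add_of_nonneg_right (by positivity)
end

section
/- Fix α > 1 and for each integer n ≥ 3 set j*(n) = ⌈log_α(log₂ n)⌉. For integers j, n define b_i(n) = (1/2)·( n(n−1)/2 )/4^i · (1 − 1/2^i)^{n−2} and p'_j(n) = Σ_{k=1}^{⌈α^j⌉} b_k(n) · ∏_{i=1, i≠k}^{⌈α^j⌉} (1 − b_i(n)). Let j : ℕ → ℕ be any function with j(n) ≥ j*(n) for all n. Then limsup_{n→∞} p'_{j(n)}(n) ≤ 0.3824. -/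
open Finset Filter
open scoped Topology

/-- Taylor lower bound for `exp`, in the form needed for the telescoping majorant. -/
lemma quartic_le_exp {y : ℝ} (hy : 0 ≤ y) :
    (4 * y ^ 2 + 4) * (y ^ 2 + 4) ≤ 28.8 * Real.exp y := by
  have h := Real.sum_le_exp_of_nonneg hy 9
  simp only [Finset.sum_range_succ, Finset.sum_range_zero, Nat.factorial] at h
  norm_num at h
  have key : (4 * y ^ 2 + 4) * (y ^ 2 + 4) ≤ 28.8 * (1 + y + y ^ 2 / 2 + y ^ 3 / 6 + y ^ 4 / 24 +
      y ^ 5 / 120 + y ^ 6 / 720 + y ^ 7 / 5040 + y ^ 8 / 40320) := by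
    rcases le_total y 2 with h2 | h2
    · nlinarith [pow_nonneg hy 3, pow_nonneg hy 5, pow_nonneg hy 6, pow_nonneg hy 7,
        pow_nonneg hy 8, mul_nonneg hy (sub_nonneg.2 h2),
        mul_nonneg (pow_nonneg hy 3) (sub_nonneg.2 h2)]
    · obtain ⟨t, rfl⟩ : ∃ t, y = 2 + t := ⟨y - 2, by ring⟩
      have ht : 0 ≤ t := by linarith
      nlinarith [pow_nonneg ht 2, pow_nonneg ht 3, pow_nonneg ht 4, pow_nonneg ht 5,
        pow_nonneg ht 6, pow_nonneg ht 7, pow_nonneg ht 8, mul_nonneg ht (sq_nonneg (t - 1.5)),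
        mul_nonneg ht (sq_nonneg (t - 2)), sq_nonneg (t * (t - 1.5)), sq_nonneg (t - 1.5),
        mul_nonneg ht (sq_nonneg (t * (t - 1.5)))]
  linarith

/-- `y² e⁻ʸ` is dominated by a dyadic increment of the bounded function `2.4 y² / (y² + 4)`. -/
lemma sq_mul_exp_neg_le_increment {y : ℝ} (hy : 0 ≤ y) :
    y ^ 2 * Real.exp (-y) ≤
      2.4 * ((2 * y) ^ 2 / ((2 * y) ^ 2 + 4) - y ^ 2 / (y ^ 2 + 4)) := by
  have h := quartic_le_exp hy
  have e : 2.4 * ((2 * y) ^ 2 / ((2 * y) ^ 2 + 4) - y ^ 2 / (y ^ 2 + 4)) =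
      y ^ 2 * (28.8 / ((4 * y ^ 2 + 4) * (y ^ 2 + 4))) := by
    have h1 : y ^ 2 + 4 ≠ 0 := by positivity
    have h2 : (2 * y) ^ 2 + 4 ≠ 0 := by positivity
    have h3 : 4 * y ^ 2 + 4 ≠ 0 := by positivity
    have h4 : y ^ 2 + 1 ≠ 0 := by positivity
    field_simp
    ring
  rw [e, Real.exp_neg, ← one_div]
  refine mul_le_mul_of_nonneg_left ?_ (sq_nonneg y)
  rw [div_le_div_iff₀ (Real.exp_pos y) (by positivity)]
  linarith

lemma sq_mul_exp_neg_le {y : ℝ} (hy : 0 ≤ y) : y ^ 2 * Real.exp (-y) ≤ 0.5424 := by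
  have h1 : (2.71828 : ℝ) ≤ Real.exp 1 := by linarith [Real.exp_one_gt_d9]
  have h2 : y / 2 ≤ Real.exp (y / 2 - 1) := by
    linarith [Real.add_one_le_exp (y / 2 - 1)]
  have h3 : 2.71828 * (y / 2) ≤ Real.exp (y / 2) := by
    calc 2.71828 * (y / 2) ≤ Real.exp 1 * Real.exp (y / 2 - 1) := by gcongr
      _ = Real.exp (y / 2) := by rw [← Real.exp_add]; congr 1; ring
  have h4 : (2.71828 * (y / 2)) ^ 2 ≤ Real.exp y := by
    calc (2.71828 * (y / 2)) ^ 2 ≤ Real.exp (y / 2) ^ 2 := by gcongr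
      _ = Real.exp y := by rw [sq, ← Real.exp_add]; congr 1; ring
  rw [Real.exp_neg, ← div_eq_mul_inv, div_le_iff₀ (Real.exp_pos y)]
  nlinarith [sq_nonneg y]

/-- The dyadic sums of `y² e⁻ʸ` are at most `2.4`. -/
lemma sum_dyadic_sq_mul_exp_neg_le {x : ℝ} (hx : 0 ≤ x) (M : ℕ) :
    ∑ i ∈ Finset.Icc 1 M, (x / 2 ^ i) ^ 2 * Real.exp (-(x / 2 ^ i)) ≤ 2.4 := by
  have tel : ∀ M : ℕ, ∑ i ∈ Finset.Icc 1 M, (x / 2 ^ i) ^ 2 * Real.exp (-(x / 2 ^ i)) ≤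
      2.4 * (x ^ 2 / (x ^ 2 + 4) - (x / 2 ^ M) ^ 2 / ((x / 2 ^ M) ^ 2 + 4)) := by
    intro M
    induction M with
    | zero => simp
    | succ M ih =>
      rw [Finset.sum_Icc_succ_top (by omega)]
      have h := sq_mul_exp_neg_le_increment (y := x / 2 ^ (M + 1)) (by positivity)
      have e : 2 * (x / 2 ^ (M + 1)) = x / 2 ^ M := by
        rw [pow_succ]; field_simp
      rw [e] at h
      linarith
  refine (tel M).trans ?_
  have h1 : x ^ 2 / (x ^ 2 + 4) ≤ 1 := (div_le_one (by positivity)).2 (by linarith)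
  have h2 : 0 ≤ (x / 2 ^ M) ^ 2 / ((x / 2 ^ M) ^ 2 + 4) := by positivity
  linarith

/-- If the probabilities `b i` are at most `β` and sum to at most `c ≤ 1`, then exactly one of
the corresponding independent events happens with probability at most `c e^(β - c)`. -/
lemma sum_mul_prod_one_sub_le {ι : Type*} [DecidableEq ι] (s : Finset ι) (b : ι → ℝ) {β c : ℝ}
    (h0 : ∀ i ∈ s, 0 ≤ b i) (hβ : ∀ i ∈ s, b i ≤ β) (hβ1 : β ≤ 1)
    (hc : ∑ i ∈ s, b i ≤ c) (hc1 : c ≤ 1) :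
    ∑ k ∈ s, b k * ∏ i ∈ s.erase k, (1 - b i) ≤ c * Real.exp (β - c) := by
  set S := ∑ i ∈ s, b i with hS
  have h1 : ∀ k ∈ s, b k * ∏ i ∈ s.erase k, (1 - b i) ≤ b k * Real.exp (β - S) := by
    intro k hk
    refine mul_le_mul_of_nonneg_left ?_ (h0 k hk)
    calc ∏ i ∈ s.erase k, (1 - b i) ≤ ∏ i ∈ s.erase k, Real.exp (-b i) := by
          refine Finset.prod_le_prod (fun i hi => ?_) (fun i _ => Real.one_sub_le_exp_neg _)
          linarith [hβ i (Finset.mem_of_mem_erase hi)]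
      _ = Real.exp (-∑ i ∈ s.erase k, b i) := by
          rw [← Real.exp_sum, Finset.sum_neg_distrib]
      _ ≤ Real.exp (β - S) := by
          refine Real.exp_le_exp.2 ?_
          linarith [Finset.add_sum_erase s b hk, hβ k hk]
  refine (Finset.sum_le_sum h1).trans ?_
  rw [← Finset.sum_mul]
  have h2 : S ≤ c * Real.exp (S - c) := by
    have hS0 : 0 ≤ S := Finset.sum_nonneg h0
    nlinarith [Real.add_one_le_exp (S - c),
      mul_nonneg (hS0.trans hc) (sub_nonneg.2 (Real.add_one_le_exp (S - c))),
      mul_nonneg (sub_nonneg.2 hc) (sub_nonneg.2 hc1)]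
  calc S * Real.exp (β - S) ≤ c * Real.exp (S - c) * Real.exp (β - S) := by gcongr
    _ = c * Real.exp (β - c) := by
      rw [mul_assoc, ← Real.exp_add]; congr 2; ring

lemma broadcast_prob_nonneg (n i : ℕ) (hn : 1 ≤ n) :
    (0 : ℝ) ≤ (1 / 2) * ((n : ℝ) * (n - 1) / 2) / 4 ^ i * (1 - 1 / 2 ^ i) ^ (n - 2) := by
  have h1 : (1 : ℝ) ≤ n := by exact_mod_cast hn
  have h2 : (1 : ℝ) / 2 ^ i ≤ 1 := by
    rw [div_le_one (by positivity)]; exact one_le_pow₀ (by norm_num)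
  have h3 : (0 : ℝ) ≤ n - 1 := by linarith
  have h4 : (0 : ℝ) ≤ 1 - 1 / 2 ^ i := by linarith
  positivity

lemma broadcast_prob_le (n i : ℕ) (hn : 1000 ≤ n) :
    (1 / 2) * ((n : ℝ) * (n - 1) / 2) / 4 ^ i * (1 - 1 / 2 ^ i) ^ (n - 2) ≤
      0.2525 * ((((n : ℝ) - 2) / 2 ^ i) ^ 2 * Real.exp (-(((n : ℝ) - 2) / 2 ^ i))) := by
  have h1 : (1000 : ℝ) ≤ n := by exact_mod_cast hn
  have h2 : (1 : ℝ) / 2 ^ i ≤ 1 := by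
    rw [div_le_one (by positivity)]; exact one_le_pow₀ (by norm_num)
  have h3 : (1 - 1 / 2 ^ i : ℝ) ^ (n - 2) ≤ Real.exp (-(((n : ℝ) - 2) / 2 ^ i)) := by
    calc (1 - 1 / 2 ^ i : ℝ) ^ (n - 2) ≤ Real.exp (-(1 / 2 ^ i)) ^ (n - 2) :=
          pow_le_pow_left₀ (by linarith) (Real.one_sub_le_exp_neg _) _
      _ = Real.exp (-(((n : ℝ) - 2) / 2 ^ i)) := by
          rw [← Real.exp_nat_mul, Nat.cast_sub (by omega)]
          congr 1; push_cast; ring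
  have h4 : (1 / 2) * ((n : ℝ) * (n - 1) / 2) / 4 ^ i ≤
      0.2525 * (((n : ℝ) - 2) / 2 ^ i) ^ 2 := by
    have e : (0.2525 : ℝ) * (((n : ℝ) - 2) / 2 ^ i) ^ 2 = 0.2525 * ((n : ℝ) - 2) ^ 2 / 4 ^ i := by
      rw [div_pow, ← pow_mul, mul_comm i 2, pow_mul]; norm_num; ring
    rw [e]
    refine div_le_div_of_nonneg_right ?_ (by positivity)
    nlinarith
  rw [← mul_assoc]
  exact mul_le_mul h4 h3 (pow_nonneg (by linarith) _) (by positivity)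

lemma exactly_one_numeric_bound : (0.606 : ℝ) * Real.exp (0.137 - 0.606) ≤ 0.3824 := by
  have h := Real.sum_le_exp_of_nonneg (x := 0.469) (by norm_num) 4
  simp only [Finset.sum_range_succ, Finset.sum_range_zero, Nat.factorial] at h
  norm_num at h
  have e : (0.137 - 0.606 : ℝ) = -0.469 := by norm_num
  rw [e, Real.exp_neg, ← div_eq_mul_inv, div_le_iff₀ (Real.exp_pos _)]
  norm_num
  linarith

/-- With `α > 1`, `j*(n) = ⌈log_α (log₂ n)⌉`,
`b_i(n) = (1/2)·(n(n-1)/2)/4^i · (1 - 1/2^i)^{n-2}` and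
`p'_j(n) = ∑_{k=1}^{⌈α^j⌉} b_k(n) ∏_{i≠k} (1 - b_i(n))`, for any `j : ℕ → ℕ` with
`j n ≥ j*(n)` for all `n`, one has `limsup_{n→∞} p'_{j n}(n) ≤ 0.3824`. -/
theorem stmt_17 (α : ℝ) (hα : 1 < α)
    (jstar : ℕ → ℕ) (hjstar : ∀ n : ℕ, jstar n = ⌈Real.logb α (Real.logb 2 n)⌉₊)
    (b : ℕ → ℕ → ℝ)
    (hb : ∀ i n : ℕ, b i n = (1 / 2) * ((n : ℝ) * (n - 1) / 2) / 4 ^ i *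
      (1 - 1 / 2 ^ i) ^ (n - 2))
    (p' : ℕ → ℕ → ℝ)
    (hp' : ∀ j n : ℕ, p' j n = ∑ k ∈ Finset.Icc 1 ⌈α ^ j⌉₊,
      b k n * ∏ i ∈ (Finset.Icc 1 ⌈α ^ j⌉₊).erase k, (1 - b i n))
    (j : ℕ → ℕ) (hj : ∀ n : ℕ, jstar n ≤ j n) :
    Filter.limsup (fun n : ℕ => p' (j n) n) Filter.atTop ≤ 0.3824 := by
  have bounds : ∀ n : ℕ, 1000 ≤ n →
      0 ≤ p' (j n) n ∧ p' (j n) n ≤ 0.3824 := by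
    intro n hn
    have hn' : (1000 : ℝ) ≤ n := by exact_mod_cast hn
    have b_nonneg : ∀ i, 0 ≤ b i n := fun i => by
      rw [hb]; exact broadcast_prob_nonneg n i (by omega)
    have b_le : ∀ i, b i n ≤ 0.2525 * ((((n : ℝ) - 2) / 2 ^ i) ^ 2 *
        Real.exp (-(((n : ℝ) - 2) / 2 ^ i))) := fun i => by
      rw [hb]; exact broadcast_prob_le n i hn
    have b_le_const : ∀ i, b i n ≤ 0.137 := fun i => by
      have h0 : 0 ≤ ((n : ℝ) - 2) / 2 ^ i := div_nonneg (by linarith) (by positivity)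
      linarith [b_le i, sq_mul_exp_neg_le h0]
    rw [hp']
    refine ⟨Finset.sum_nonneg fun k _ => mul_nonneg (b_nonneg k)
      (Finset.prod_nonneg fun i _ => by linarith [b_le_const i]), ?_⟩
    refine (sum_mul_prod_one_sub_le _ (fun i => b i n) (fun i _ => b_nonneg i)
      (fun i _ => b_le_const i) (by norm_num) (c := 0.606) ?_ (by norm_num)).trans
      exactly_one_numeric_bound
    refine (Finset.sum_le_sum fun i _ => b_le i).trans ?_
    rw [← Finset.mul_sum]
    linarith [sum_dyadic_sq_mul_exp_neg_le (x := (n : ℝ) - 2) (by linarith) ⌈α ^ j n⌉₊]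
  have hev : ∀ᶠ n : ℕ in atTop, 1000 ≤ n := eventually_ge_atTop 1000
  refine Filter.limsup_le_of_le ?_ (hev.mono fun n hn => (bounds n hn).2)
  exact Filter.IsCoboundedUnder.of_frequently_ge
    (a := 0) (hev.mono fun n hn => (bounds n hn).1).frequently
end

section
/- Fix α > 1 and ε ∈ (0,1); for n ≥ 2 set j*(n) = ⌈log_α(log₂ n)⌉ and s_j(n) = ∏_{i=1}^{⌈α^j⌉} ( 1 − (n/2^i)(1 − 1/2^i)^{n−1} ). Then ∏_{j=1}^{⌊(1−ε) j*(n)⌋} s_j(n) → 1 as n → ∞. In other words, the probability that Algorithm 1 produces a candidate in any of the first ⌊(1−ε) j*(n)⌋ rounds tends to 0. -/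
open Finset Filter
open scoped Topology

/-- The probability that exactly one of `n` stations broadcasts is negligible when the
broadcasting probability `q` is at least `1 / √n`. -/
lemma mul_one_sub_pow_le_mul_exp {n : ℕ} (hn : 1 ≤ n) {q : ℝ} (hq : 1 / √(n : ℝ) ≤ q) (hq1 : q ≤ 1) :
    n * q * (1 - q) ^ (n - 1) ≤ n * Real.exp (1 - √(n : ℝ)) := by
  have hn' : (1 : ℝ) ≤ n := by exact_mod_cast hn
  have hs : 1 ≤ √(n : ℝ) := Real.one_le_sqrt.mpr hn'
  have hss : √(n : ℝ) * √(n : ℝ) = n := Real.mul_self_sqrt (by linarith)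
  have hexp : (1 - q) ^ (n - 1) ≤ Real.exp (1 - √(n : ℝ)) := by
    calc (1 - q) ^ (n - 1) ≤ Real.exp (-q) ^ (n - 1) :=
          pow_le_pow_left₀ (by linarith) (Real.one_sub_le_exp_neg q) _
      _ = Real.exp (((n : ℝ) - 1) * -q) := by
          rw [← Real.exp_nat_mul, Nat.cast_sub hn, Nat.cast_one]
      _ ≤ Real.exp (1 - √(n : ℝ)) := by
          apply Real.exp_le_exp.mpr
          have h1 : ((n : ℝ) - 1) * (1 / √(n : ℝ)) ≤ ((n : ℝ) - 1) * q :=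
            mul_le_mul_of_nonneg_left hq (by linarith)
          have h2 : √(n : ℝ) - 1 ≤ ((n : ℝ) - 1) * (1 / √(n : ℝ)) := by
            rw [mul_one_div, le_div_iff₀ (by linarith)]
            nlinarith
          linarith
  have h0 : 0 ≤ q := le_trans (by positivity) hq
  exact mul_le_mul (mul_le_of_le_one_right (by linarith) hq1) hexp
    (pow_nonneg (by linarith) _) (by linarith)

lemma pow_le_prod_and_prod_le_one {ι : Type*} {t : Finset ι} {f : ι → ℝ} {c : ℝ} {k : ℕ}
    (hc0 : 0 ≤ c) (hc1 : c ≤ 1) (hk : #t ≤ k) (hf : ∀ i ∈ t, c ≤ f i ∧ f i ≤ 1) :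
    c ^ k ≤ ∏ i ∈ t, f i ∧ ∏ i ∈ t, f i ≤ 1 :=
  ⟨(pow_le_pow_of_le_one hc0 hc1 hk).trans
      (by simpa using Finset.prod_le_prod (fun _ _ ↦ hc0) fun i hi ↦ (hf i hi).1),
    Finset.prod_le_one (fun i hi ↦ hc0.trans (hf i hi).1) fun i hi ↦ (hf i hi).2⟩

lemma pow_floor_mul_ceil_logb_le {α ε L : ℝ} (hα : 1 < α) (hε0 : 0 < ε) (hε1 : ε < 1)
    (hL : 1 ≤ L) : α ^ ⌊(1 - ε) * (⌈Real.logb α L⌉₊ : ℝ)⌋₊ ≤ α * L ^ (1 - ε) := by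
  have hα0 : 0 < α := by linarith
  have hlog : 0 ≤ Real.logb α L := Real.logb_nonneg hα hL
  have hceil := Nat.ceil_lt_add_one hlog
  have hfloor : (⌊(1 - ε) * (⌈Real.logb α L⌉₊ : ℝ)⌋₊ : ℝ) ≤ (1 - ε) * ⌈Real.logb α L⌉₊ :=
    Nat.floor_le (mul_nonneg (by linarith) (Nat.cast_nonneg _))
  calc α ^ ⌊(1 - ε) * (⌈Real.logb α L⌉₊ : ℝ)⌋₊
      = α ^ (⌊(1 - ε) * (⌈Real.logb α L⌉₊ : ℝ)⌋₊ : ℝ) := (Real.rpow_natCast _ _).symm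
    _ ≤ α ^ (1 + Real.logb α L * (1 - ε)) :=
        Real.rpow_le_rpow_of_exponent_le hα.le (by nlinarith)
    _ = α * L ^ (1 - ε) := by
        rw [Real.rpow_add hα0, Real.rpow_one, Real.rpow_mul hα0.le,
          Real.rpow_logb hα0 hα.ne' (by linarith)]

lemma eventually_mul_rpow_add_one_le_half (α : ℝ) {ε : ℝ} (hε0 : 0 < ε) :
    ∀ᶠ L : ℝ in atTop, α * L ^ (1 - ε) + 1 ≤ L / 2 := by
  have h := (tendsto_rpow_neg_atTop hε0).const_mul α
  rw [mul_zero] at h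
  filter_upwards [h.eventually_le_const (show (0 : ℝ) < 1 / 4 by norm_num),
    eventually_ge_atTop 4] with L h1 h2
  rw [sub_eq_add_neg, Real.rpow_add (by linarith), Real.rpow_one]
  nlinarith

lemma two_pow_le_sqrt {n k : ℕ} (hn : 1 ≤ n) (hk : (k : ℝ) ≤ Real.logb 2 n / 2) :
    (2 : ℝ) ^ k ≤ √(n : ℝ) := by
  have hn' : (0 : ℝ) < n := by exact_mod_cast hn
  have h := (Real.le_logb_iff_rpow_le one_lt_two hn').mp (show (k : ℝ) * 2 ≤ _ by linarith)
  apply Real.le_sqrt_of_sq_le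
  rwa [Real.rpow_mul two_pos.le, Real.rpow_natCast, Real.rpow_two] at h

lemma tendsto_pow_three_mul_exp_one_sub_sqrt :
    Tendsto (fun n : ℕ ↦ (n : ℝ) ^ 3 * Real.exp (1 - √(n : ℝ))) atTop (𝓝 0) := by
  have h := ((Real.tendsto_pow_mul_exp_neg_atTop_nhds_zero 6).comp
    (Real.tendsto_sqrt_atTop.comp tendsto_natCast_atTop_atTop)).const_mul (Real.exp 1)
  rw [mul_zero] at h
  refine h.congr fun n ↦ ?_
  have hs : √(n : ℝ) ^ 6 = (n : ℝ) ^ 3 := by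
    rw [show 6 = 2 * 3 from rfl, pow_mul, Real.sq_sqrt (Nat.cast_nonneg n)]
  simp only [Function.comp_apply, hs, sub_eq_add_neg, Real.exp_add]
  ring

/-- With `α > 1`, `ε ∈ (0,1)`, `j*(n) = ⌈log_α (log₂ n)⌉` and
`s_j(n) = ∏_{i=1}^{⌈α^j⌉} (1 - (n/2^i)(1 - 1/2^i)^{n-1})`, one has
`∏_{j=1}^{⌊(1-ε) j*(n)⌋} s_j(n) → 1` as `n → ∞`: the probability that Algorithm 1
produces a candidate in any of the first `⌊(1-ε) j*(n)⌋` rounds tends to `0`. -/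
theorem stmt_18 (α : ℝ) (hα : 1 < α) (ε : ℝ) (hε0 : 0 < ε) (hε1 : ε < 1)
    (jstar : ℕ → ℕ) (hjstar : ∀ n : ℕ, jstar n = ⌈Real.logb α (Real.logb 2 n)⌉₊)
    (s : ℕ → ℕ → ℝ)
    (hs : ∀ j n : ℕ, s j n = ∏ i ∈ Finset.Icc 1 ⌈α ^ j⌉₊,
      (1 - ((n : ℝ) / 2 ^ i) * (1 - 1 / 2 ^ i) ^ (n - 1))) :
    Filter.Tendsto
      (fun n : ℕ => ∏ j ∈ Finset.Icc 1 ⌊(1 - ε) * (jstar n : ℝ)⌋₊, s j n)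
      Filter.atTop (𝓝 1) := by
  have hα0 : 0 < α - 1 := by linarith
  have hlogb : Tendsto (fun n : ℕ ↦ Real.logb 2 n) atTop atTop :=
    (Real.tendsto_logb_atTop one_lt_two).comp tendsto_natCast_atTop_atTop
  have hlim := tendsto_pow_three_mul_exp_one_sub_sqrt.const_mul (1 / (α - 1))
  rw [mul_zero] at hlim
  have hlower := hlim.const_sub 1
  rw [sub_zero] at hlower
  have hδ_le : ∀ᶠ n : ℕ in atTop, (n : ℝ) ^ 3 * Real.exp (1 - √(n : ℝ)) ≤ 1 :=
    tendsto_pow_three_mul_exp_one_sub_sqrt.eventually_le_const one_pos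
  have key : ∀ᶠ n : ℕ in atTop,
      1 - 1 / (α - 1) * ((n : ℝ) ^ 3 * Real.exp (1 - √(n : ℝ))) ≤
          ∏ j ∈ Finset.Icc 1 ⌊(1 - ε) * (jstar n : ℝ)⌋₊, s j n ∧
        ∏ j ∈ Finset.Icc 1 ⌊(1 - ε) * (jstar n : ℝ)⌋₊, s j n ≤ 1 := by
    filter_upwards [hδ_le, hlogb.eventually (eventually_mul_rpow_add_one_le_half α hε0),
      hlogb.eventually_ge_atTop 1, eventually_ge_atTop 1] with n hδ hhalf hL hn
    have hn' : (1 : ℝ) ≤ n := by exact_mod_cast hn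
    have hpow := pow_floor_mul_ceil_logb_le hα hε0 hε1 hL
    rw [← hjstar] at hpow
    set m := ⌊(1 - ε) * (jstar n : ℝ)⌋₊
    set K := ⌈α ^ m⌉₊
    set δ : ℝ := n * Real.exp (1 - √(n : ℝ))
    have hδ0 : 0 ≤ δ := by positivity
    have hδ3 : (n : ℝ) ^ 3 * Real.exp (1 - √(n : ℝ)) = n ^ 2 * δ := by ring
    rw [hδ3] at hδ ⊢
    have hδ1 : δ ≤ 1 := le_trans (le_mul_of_one_le_left hδ0 (one_le_pow₀ hn')) hδ
    have hK : (K : ℝ) ≤ Real.logb 2 n / 2 := by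
      have := Nat.ceil_lt_add_one (show 0 ≤ α ^ m by positivity)
      linarith
    have hKsqrt := two_pow_le_sqrt hn hK
    have hfactor : ∀ i ≤ K,
        1 - δ ≤ 1 - ((n : ℝ) / 2 ^ i) * (1 - 1 / 2 ^ i) ^ (n - 1) ∧
          1 - ((n : ℝ) / 2 ^ i) * (1 - 1 / 2 ^ i) ^ (n - 1) ≤ 1 := by
      intro i hi
      have hi1 : (1 : ℝ) / 2 ^ i ≤ 1 := by
        rw [div_le_one (by positivity)]
        exact one_le_pow₀ one_le_two
      have hi2 : 1 / √(n : ℝ) ≤ 1 / 2 ^ i :=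
        one_div_le_one_div_of_le (by positivity)
          ((pow_le_pow_right₀ one_le_two hi).trans hKsqrt)
      have hle := mul_one_sub_pow_le_mul_exp hn hi2 hi1
      rw [mul_one_div] at hle
      have hnn : 0 ≤ ((n : ℝ) / 2 ^ i) * (1 - 1 / 2 ^ i) ^ (n - 1) :=
        mul_nonneg (by positivity) (pow_nonneg (by linarith) _)
      exact ⟨by linarith, by linarith⟩
    have hround : ∀ j ∈ Finset.Icc 1 m, (1 - δ) ^ K ≤ s j n ∧ s j n ≤ 1 := by
      intro j hj
      have hjK : ⌈α ^ j⌉₊ ≤ K :=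
        Nat.ceil_mono (pow_le_pow_right₀ hα.le (Finset.mem_Icc.mp hj).2)
      rw [hs]
      exact pow_le_prod_and_prod_le_one (by linarith) (by linarith) (by simpa using hjK)
        fun i hi ↦ hfactor i ((Finset.mem_Icc.mp hi).2.trans hjK)
    have hprod := pow_le_prod_and_prod_le_one (k := m) (pow_nonneg (by linarith) K)
      (pow_le_one₀ (by linarith) (by linarith)) (by simp) hround
    refine ⟨le_trans ?_ hprod.1, hprod.2⟩
    have hbern : 1 - (K * m : ℕ) * δ ≤ ((1 - δ) ^ K) ^ m := by
      rw [← pow_mul]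
      simpa [sub_eq_add_neg] using
        one_add_mul_le_pow (show (-2 : ℝ) ≤ -δ by linarith) (K * m)
    have hKn : (K : ℝ) ≤ n := by
      have h2 : (K : ℝ) ≤ 2 ^ K := by exact_mod_cast Nat.lt_two_pow_self.le
      have h3 : √(n : ℝ) ≤ n := Real.sqrt_le_self_iff.mpr (Or.inr hn')
      linarith
    have hm : (m : ℝ) ≤ 1 / (α - 1) * n := by
      have h1 := one_add_mul_sub_le_pow (show (-1 : ℝ) ≤ α by linarith) m
      have h2 : α ^ m ≤ K := Nat.le_ceil _
      rw [one_div_mul_eq_div, le_div_iff₀ hα0]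
      linarith
    have hKm : (K : ℝ) * m ≤ n * (1 / (α - 1) * n) :=
      mul_le_mul hKn hm (Nat.cast_nonneg _) (by linarith)
    have := mul_le_mul_of_nonneg_right hKm hδ0
    push_cast at hbern
    linarith
  exact tendsto_of_tendsto_of_tendsto_of_le_of_le' hlower tendsto_const_nhds
    (key.mono fun _ h ↦ h.1) (key.mono fun _ h ↦ h.2)
end
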